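/- Assume Condition (D). Let Ψ_1, Ψ_2 be a pair of Young functions and let f : X → ℝ be measurable with ‖f‖_W < ∞, where W(x) = Ψ_2(φ(V(x))/φ(1)). Then for all x, x' ∈ X, Σ_{n=0}^∞ Ψ_1(r(n)) |P^(n) f(x) − P^(n) f(x')| ≤ c · (V(x) + V(x') − 1) · ‖f‖_W, where c is the explicit constant c = (2/(ε_b φ(1)))[2 + b̄/ε_ν + c_* b̄ r(1)(1 + r(1)/(ε_b φ(1)))]. -/

import Mathlib

open MeasureTheory ProbabilityTheory Filter Set

noncomputable def iterKernel {X : Type*} [MeasurableSpace X]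
    (P : ℕ → Kernel X X) : ℕ → Kernel X X
  | 0 => Kernel.id
  | n + 1 => (P (n + 1)).comp (iterKernel P n)

noncomputable def Hfun (φ : ℝ → ℝ) (t : ℝ) : ℝ := ∫ s in (1:ℝ)..t, (φ s)⁻¹

noncomputable def Hinv (φ : ℝ → ℝ) : ℝ → ℝ := Function.invFunOn (Hfun φ) (Set.Ici 1)

noncomputable def rate (φ : ℝ → ℝ) (εb : ℝ) (n : ℕ) : ℝ := φ (Hinv φ (εb * n)) / φ 1

noncomputable def deltaSeq (φ : ℝ → ℝ) (εb : ℝ) (k : ℕ) : ℝ := εb * deriv φ (Hinv φ (εb * k))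

noncomputable def bbar (φ : ℝ → ℝ) (εb bV : ℝ) : ℝ := 2 * bV + εb * φ 1

noncomputable def Mone (φ : ℝ → ℝ) (εb εν bV cV : ℝ) : ℝ :=
  rate φ εb 1 * (1 + 2 * rate φ εb 1 / (εb * φ 1) * ((bV + cV) / (1 - εν) - 1))

noncomputable def cstar (φ : ℝ → ℝ) (εb εν bV cV : ℝ) : ℝ :=
  ∑' j : ℕ, (1 - εν) ^ j * ∏ k ∈ Finset.Icc 1 j, (1 + deltaSeq φ εb k * Mone φ εb εν bV cV)

noncomputable def cconst (φ : ℝ → ℝ) (εb εν bV cV : ℝ) : ℝ :=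
  2 / (εb * φ 1) * (2 + bbar φ εb bV / εν +
    cstar φ εb εν bV cV * bbar φ εb bV * rate φ εb 1 * (1 + rate φ εb 1 / (εb * φ 1)))

noncomputable def Qmeas {X : Type*} [MeasurableSpace X]
    (P : ℕ → Kernel X X) (ν : ℕ → Measure X) (εν : ℝ) (k : ℕ) (x : X) : Measure X :=
  (ENNReal.ofReal (1 - εν))⁻¹ • (P k x - ENNReal.ofReal εν • ν k)

/-- The standing assumptions on the drift function `φ`, except for the decay of its derivative. -/
structure IsDriftFunction (φ : ℝ → ℝ) : Prop where
  concaveOn : ConcaveOn ℝ (Ici 1) φ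
  monotoneOn : MonotoneOn φ (Ici 1)
  differentiableAt : ∀ t, 1 ≤ t → DifferentiableAt ℝ φ t
  pos : ∀ t, 1 ≤ t → 0 < φ t

namespace IsDriftFunction

variable {φ : ℝ → ℝ}

lemma continuousOn (hφ : IsDriftFunction φ) : ContinuousOn φ (Ici 1) :=
  fun t ht => (hφ.differentiableAt t ht).continuousAt.continuousWithinAt

lemma antitoneOn_deriv (hφ : IsDriftFunction φ) : AntitoneOn (deriv φ) (Ici 1) :=
  hφ.concaveOn.antitoneOn_deriv hφ.differentiableAt

lemma deriv_nonneg (hφ : IsDriftFunction φ) {t : ℝ} (ht : 1 ≤ t) : 0 ≤ deriv φ t := by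
  have ht' : t + 1 ∈ Ici (1 : ℝ) := by simp only [mem_Ici]; linarith
  refine le_trans ?_ (hφ.concaveOn.slope_le_deriv ht ht' (by linarith) (hφ.differentiableAt t ht))
  rw [slope_def_field]
  have := hφ.monotoneOn ht ht' (by linarith)
  exact div_nonneg (by linarith) (by linarith)

lemma le_affine (hφ : IsDriftFunction φ) {t : ℝ} (ht : 1 ≤ t) :
    φ t ≤ φ 1 + deriv φ 1 * (t - 1) := by
  rcases ht.eq_or_lt with rfl | h
  · simp
  · have := hφ.concaveOn.slope_le_deriv self_mem_Ici ht h (hφ.differentiableAt 1 le_rfl)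
    rw [slope_def_field, div_le_iff₀ (by linarith)] at this
    linarith

lemma one_add_le_add (hφ : IsDriftFunction φ) {a b : ℝ} (ha : 1 ≤ a) (hb : 1 ≤ b) :
    φ 1 + φ (a + b - 1) ≤ φ a + φ b := by
  rcases ha.eq_or_lt with rfl | ha
  · simp
  rcases hb.eq_or_lt with rfl | hb
  · simp [add_comm]
  have hab : a + b - 1 ∈ Ici (1 : ℝ) := by simp only [mem_Ici]; linarith
  have hs : 0 < a + b - 2 := by linarith
  have h1 := hφ.concaveOn.2 (self_mem_Ici (a := (1 : ℝ))) hab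
    (div_nonneg (sub_nonneg.2 hb.le) hs.le) (div_nonneg (sub_nonneg.2 ha.le) hs.le)
    (by field_simp; ring)
  have h2 := hφ.concaveOn.2 (self_mem_Ici (a := (1 : ℝ))) hab
    (div_nonneg (sub_nonneg.2 ha.le) hs.le) (div_nonneg (sub_nonneg.2 hb.le) hs.le)
    (by field_simp; ring)
  simp only [smul_eq_mul] at h1 h2
  have e1 : (b - 1) / (a + b - 2) * 1 + (a - 1) / (a + b - 2) * (a + b - 1) = a := by
    field_simp; ring
  have e2 : (a - 1) / (a + b - 2) * 1 + (b - 1) / (a + b - 2) * (a + b - 1) = b := by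
    field_simp; ring
  rw [e1] at h1
  rw [e2] at h2
  have e3 : (b - 1) / (a + b - 2) + (a - 1) / (a + b - 2) = 1 := by field_simp; ring
  linear_combination h1 + h2 - e3 * (φ 1 + φ (a + b - 1))

lemma continuousOn_inv (hφ : IsDriftFunction φ) : ContinuousOn (fun s => (φ s)⁻¹) (Ici 1) :=
  hφ.continuousOn.inv₀ fun t ht => (hφ.pos t ht).ne'

lemma hasDerivAt_Hfun (hφ : IsDriftFunction φ) {w : ℝ} (hw : 1 < w) :
    HasDerivAt (Hfun φ) (φ w)⁻¹ w := by
  have hsub : uIcc 1 w ⊆ Ici (1 : ℝ) := by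
    rw [uIcc_of_le hw.le]; exact Icc_subset_Ici_self
  refine intervalIntegral.integral_hasDerivAt_right
    (hφ.continuousOn_inv.mono hsub).intervalIntegrable ?_
    (hφ.continuousOn_inv.continuousAt (Ici_mem_nhds hw))
  exact (hφ.continuousOn_inv.mono Ioi_subset_Ici_self).stronglyMeasurableAtFilter isOpen_Ioi w hw

lemma continuousOn_Hfun (hφ : IsDriftFunction φ) : ContinuousOn (Hfun φ) (Ici 1) := by
  intro w hw
  have hw' : (1 : ℝ) ≤ w + 1 := by simp only [mem_Ici] at hw; linarith
  have hint : IntegrableOn (fun s => (φ s)⁻¹) (uIcc 1 (w + 1)) := by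
    rw [uIcc_of_le hw']
    exact (hφ.continuousOn_inv.mono Icc_subset_Ici_self).integrableOn_Icc
  have h := intervalIntegral.continuousOn_primitive_interval hint
  rw [uIcc_of_le hw'] at h
  refine (h w ⟨hw, by linarith⟩).mono_of_mem_nhdsWithin ?_
  rw [← Ici_inter_Iic]
  exact inter_mem self_mem_nhdsWithin (mem_nhdsWithin_of_mem_nhds (Iic_mem_nhds (by linarith)))

lemma Hfun_one : Hfun φ 1 = 0 := intervalIntegral.integral_same

lemma strictMonoOn_Hfun (hφ : IsDriftFunction φ) : StrictMonoOn (Hfun φ) (Ici 1) := by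
  refine strictMonoOn_of_deriv_pos (convex_Ici 1) hφ.continuousOn_Hfun fun x hx => ?_
  rw [interior_Ici] at hx
  rw [(hφ.hasDerivAt_Hfun hx).deriv]
  exact inv_pos.2 (hφ.pos x (le_of_lt hx))

lemma Hfun_nonneg (hφ : IsDriftFunction φ) {w : ℝ} (hw : 1 ≤ w) : 0 ≤ Hfun φ w := by
  rw [← Hfun_one (φ := φ)]
  exact hφ.strictMonoOn_Hfun.monotoneOn self_mem_Ici hw hw

lemma Hfun_pos (hφ : IsDriftFunction φ) {w : ℝ} (hw : 1 < w) : 0 < Hfun φ w := by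
  rw [← Hfun_one (φ := φ)]
  exact hφ.strictMonoOn_Hfun self_mem_Ici hw.le hw

lemma tendsto_Hfun (hφ : IsDriftFunction φ) : Tendsto (Hfun φ) atTop atTop := by
  set c := φ 1 + deriv φ 1
  have h1 := hφ.pos 1 le_rfl
  have h2 := hφ.deriv_nonneg le_rfl
  have hc : 0 < c := by positivity
  have hle : ∀ t, 1 ≤ t → φ t ≤ c * t := fun t ht => by
    have := hφ.le_affine ht
    nlinarith
  have hmono : MonotoneOn (fun t => Hfun φ t - Real.log t / c) (Ici 1) := by
    refine monotoneOn_of_deriv_nonneg (convex_Ici 1) ?_ ?_ ?_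
    · refine hφ.continuousOn_Hfun.sub (ContinuousOn.div_const ?_ c)
      exact Real.continuousOn_log.mono fun t (ht : 1 ≤ t) => by
        simp only [mem_compl_iff, mem_singleton_iff]; linarith
    · intro t ht
      rw [interior_Ici, mem_Ioi] at ht
      exact ((hφ.hasDerivAt_Hfun ht).sub
        ((Real.hasDerivAt_log (by linarith)).div_const c)).differentiableAt.differentiableWithinAt
    · intro t ht
      rw [interior_Ici, mem_Ioi] at ht
      have hd := (hφ.hasDerivAt_Hfun ht).sub
        ((Real.hasDerivAt_log (x := t) (by linarith)).div_const c)
      have hd' : deriv (fun t => Hfun φ t - Real.log t / c) t = (φ t)⁻¹ - t⁻¹ / c := hd.deriv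
      have ht0 : 0 < t := by linarith
      rw [hd', sub_nonneg, div_eq_mul_inv, ← mul_inv, mul_comm]
      exact inv_anti₀ (hφ.pos t ht.le) (hle t ht.le)
  refine tendsto_atTop_mono' atTop ?_ (Real.tendsto_log_atTop.atTop_div_const hc)
  filter_upwards [eventually_ge_atTop 1] with t ht
  have := hmono self_mem_Ici ht ht
  simpa [Hfun_one] using this

lemma exists_Hfun_eq (hφ : IsDriftFunction φ) {s : ℝ} (hs : 0 ≤ s) : ∃ w ∈ Ici 1, Hfun φ w = s :=
  intermediate_value_Ici hφ.continuousOn_Hfun hφ.tendsto_Hfun (by rwa [Hfun_one])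

lemma one_le_Hinv (hφ : IsDriftFunction φ) {s : ℝ} (hs : 0 ≤ s) : 1 ≤ Hinv φ s :=
  Function.invFunOn_mem (hφ.exists_Hfun_eq hs)

lemma Hfun_Hinv (hφ : IsDriftFunction φ) {s : ℝ} (hs : 0 ≤ s) : Hfun φ (Hinv φ s) = s :=
  Function.invFunOn_eq (hφ.exists_Hfun_eq hs)

lemma Hinv_Hfun (hφ : IsDriftFunction φ) {w : ℝ} (hw : 1 ≤ w) : Hinv φ (Hfun φ w) = w :=
  hφ.strictMonoOn_Hfun.injOn.leftInvOn_invFunOn hw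

lemma Hinv_zero (hφ : IsDriftFunction φ) : Hinv φ 0 = 1 := by
  rw [← Hfun_one (φ := φ), hφ.Hinv_Hfun le_rfl]

lemma strictMonoOn_Hinv (hφ : IsDriftFunction φ) : StrictMonoOn (Hinv φ) (Ici 0) := by
  intro a ha b hb hab
  rw [← hφ.strictMonoOn_Hfun.lt_iff_lt (hφ.one_le_Hinv ha) (hφ.one_le_Hinv hb),
    hφ.Hfun_Hinv ha, hφ.Hfun_Hinv hb]
  exact hab

lemma image_Hinv (hφ : IsDriftFunction φ) : Hinv φ '' Ici 0 = Ici 1 := by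
  ext w
  constructor
  · rintro ⟨s, hs, rfl⟩
    exact hφ.one_le_Hinv hs
  · exact fun hw => ⟨Hfun φ w, hφ.Hfun_nonneg hw, hφ.Hinv_Hfun hw⟩

lemma one_lt_Hinv (hφ : IsDriftFunction φ) {s : ℝ} (hs : 0 < s) : 1 < Hinv φ s := by
  rw [← hφ.Hinv_zero]
  exact hφ.strictMonoOn_Hinv self_mem_Ici hs.le hs

lemma continuousAt_Hinv (hφ : IsDriftFunction φ) {s : ℝ} (hs : 0 < s) :
    ContinuousAt (Hinv φ) s := by
  refine continuousAt_of_monotoneOn_of_image_mem_nhds hφ.strictMonoOn_Hinv.monotoneOn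
    (Ici_mem_nhds hs) ?_
  rw [hφ.image_Hinv]
  exact Ici_mem_nhds (hφ.one_lt_Hinv hs)

lemma continuousOn_Hinv (hφ : IsDriftFunction φ) : ContinuousOn (Hinv φ) (Ici 0) := by
  intro s hs
  rcases (mem_Ici.1 hs).eq_or_lt with rfl | h
  · refine continuousWithinAt_right_of_monotoneOn_of_image_mem_nhdsWithin
      hφ.strictMonoOn_Hinv.monotoneOn self_mem_nhdsWithin ?_
    rw [hφ.image_Hinv, hφ.Hinv_zero]
    exact self_mem_nhdsWithin
  · exact (hφ.continuousAt_Hinv h).continuousWithinAt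

lemma hasDerivAt_Hinv (hφ : IsDriftFunction φ) {s : ℝ} (hs : 0 < s) :
    HasDerivAt (Hinv φ) (φ (Hinv φ s)) s := by
  have hpos := hφ.pos _ (hφ.one_le_Hinv hs.le)
  have := HasDerivAt.of_local_left_inverse (hφ.continuousAt_Hinv hs)
    (hφ.hasDerivAt_Hfun (hφ.one_lt_Hinv hs)) (inv_pos.2 hpos).ne'
    (by filter_upwards [Ici_mem_nhds hs] with y hy using hφ.Hfun_Hinv hy)
  rwa [inv_inv] at this

lemma tendsto_Hinv (hφ : IsDriftFunction φ) : Tendsto (Hinv φ) atTop atTop := by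
  refine tendsto_atTop.2 fun b => ?_
  have hb : (1 : ℝ) ≤ max b 1 := le_max_right _ _
  filter_upwards [eventually_ge_atTop (Hfun φ (max b 1))] with s hs
  have h0 := hφ.Hfun_nonneg hb
  have := hφ.strictMonoOn_Hinv.monotoneOn h0 (h0.trans hs) hs
  rw [hφ.Hinv_Hfun hb] at this
  exact (le_max_left _ _).trans this

lemma Hinv_mono (hφ : IsDriftFunction φ) {a b : ℝ} (ha : 0 ≤ a) (hab : a ≤ b) :
    Hinv φ a ≤ Hinv φ b :=
  hφ.strictMonoOn_Hinv.monotoneOn ha (ha.trans hab) hab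

lemma comp_Hinv_mono (hφ : IsDriftFunction φ) {a b : ℝ} (ha : 0 ≤ a) (hab : a ≤ b) :
    φ (Hinv φ a) ≤ φ (Hinv φ b) :=
  hφ.monotoneOn (hφ.one_le_Hinv ha) (hφ.one_le_Hinv (ha.trans hab)) (hφ.Hinv_mono ha hab)

lemma comp_Hinv_pos (hφ : IsDriftFunction φ) {a : ℝ} (ha : 0 ≤ a) : 0 < φ (Hinv φ a) :=
  hφ.pos _ (hφ.one_le_Hinv ha)

lemma continuousOn_comp_Hinv (hφ : IsDriftFunction φ) :
    ContinuousOn (fun s => φ (Hinv φ s)) (Ici 0) :=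
  hφ.continuousOn.comp hφ.continuousOn_Hinv fun _ hs => hφ.one_le_Hinv hs

lemma hasDerivAt_comp_Hinv (hφ : IsDriftFunction φ) {s : ℝ} (hs : 0 < s) :
    HasDerivAt (fun s => φ (Hinv φ s)) (deriv φ (Hinv φ s) * φ (Hinv φ s)) s :=
  (hφ.differentiableAt _ (hφ.one_le_Hinv hs.le)).hasDerivAt.comp s (hφ.hasDerivAt_Hinv hs)

lemma Hinv_sub_bounds (hφ : IsDriftFunction φ) {a b : ℝ} (ha : 0 ≤ a) (hab : a ≤ b) :
    φ (Hinv φ a) * (b - a) ≤ Hinv φ b - Hinv φ a ∧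
      Hinv φ b - Hinv φ a ≤ φ (Hinv φ b) * (b - a) := by
  rcases hab.eq_or_lt with rfl | h
  · simp
  obtain ⟨c, hc, he⟩ := exists_hasDerivAt_eq_slope (Hinv φ) (fun s => φ (Hinv φ s)) h
    (hφ.continuousOn_Hinv.mono fun x hx => ha.trans hx.1)
    fun x hx => hφ.hasDerivAt_Hinv (ha.trans_lt hx.1)
  have hba : 0 < b - a := by linarith
  rw [eq_div_iff hba.ne'] at he
  rw [← he]
  exact ⟨mul_le_mul_of_nonneg_right (hφ.comp_Hinv_mono ha hc.1.le) hba.le,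
    mul_le_mul_of_nonneg_right (hφ.comp_Hinv_mono (ha.trans hc.1.le) hc.2.le) hba.le⟩

lemma comp_Hinv_sub_le (hφ : IsDriftFunction φ) {a b : ℝ} (ha : 0 ≤ a) (hab : a ≤ b) :
    φ (Hinv φ b) - φ (Hinv φ a) ≤ deriv φ (Hinv φ a) * φ (Hinv φ b) * (b - a) := by
  rcases hab.eq_or_lt with rfl | h
  · simp
  obtain ⟨c, hc, he⟩ := exists_hasDerivAt_eq_slope (fun s => φ (Hinv φ s))
    (fun s => deriv φ (Hinv φ s) * φ (Hinv φ s)) h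
    (hφ.continuousOn_comp_Hinv.mono fun x hx => ha.trans hx.1)
    fun x hx => hφ.hasDerivAt_comp_Hinv (ha.trans_lt hx.1)
  have hba : 0 < b - a := by linarith
  have hc0 : 0 ≤ c := ha.trans hc.1.le
  rw [eq_div_iff hba.ne'] at he
  rw [← he]
  refine mul_le_mul_of_nonneg_right ?_ hba.le
  exact mul_le_mul (hφ.antitoneOn_deriv (hφ.one_le_Hinv ha) (hφ.one_le_Hinv hc0)
    (hφ.Hinv_mono ha hc.1.le)) (hφ.comp_Hinv_mono hc0 hc.2.le) (hφ.comp_Hinv_pos hc0).le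
    (hφ.deriv_nonneg (hφ.one_le_Hinv ha))

lemma antitoneOn_comp_Hinv_ratio (hφ : IsDriftFunction φ) {t : ℝ} (ht : 0 ≤ t) :
    AntitoneOn (fun s => φ (Hinv φ (s + t)) / φ (Hinv φ s)) (Ici 0) := by
  have hd : ∀ s ∈ interior (Ici (0 : ℝ)), HasDerivAt (fun s => φ (Hinv φ (s + t)) / φ (Hinv φ s))
      ((deriv φ (Hinv φ (s + t)) * φ (Hinv φ (s + t)) * φ (Hinv φ s) -
        φ (Hinv φ (s + t)) * (deriv φ (Hinv φ s) * φ (Hinv φ s))) / φ (Hinv φ s) ^ 2) s := by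
    intro s hs
    rw [interior_Ici, mem_Ioi] at hs
    exact ((hφ.hasDerivAt_comp_Hinv (by linarith : 0 < s + t)).comp_add_const s t).div
      (hφ.hasDerivAt_comp_Hinv hs) (hφ.comp_Hinv_pos hs.le).ne'
  refine antitoneOn_of_deriv_nonpos (convex_Ici 0) ?_
    (fun s hs => (hd s hs).differentiableAt.differentiableWithinAt) fun s hs => ?_
  · refine ContinuousOn.div (hφ.continuousOn_comp_Hinv.comp (by fun_prop)
      fun s hs => ?_) hφ.continuousOn_comp_Hinv fun s hs => (hφ.comp_Hinv_pos hs).ne'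
    simp only [mem_Ici] at hs ⊢
    linarith
  · rw [(hd s hs).deriv]
    rw [interior_Ici, mem_Ioi] at hs
    have hst : 0 ≤ s + t := by linarith
    refine div_nonpos_of_nonpos_of_nonneg ?_ (sq_nonneg _)
    have h1 := hφ.antitoneOn_deriv (hφ.one_le_Hinv hs.le) (hφ.one_le_Hinv hst)
      (hφ.Hinv_mono hs.le (by linarith))
    have h2 := mul_pos (hφ.comp_Hinv_pos hs.le) (hφ.comp_Hinv_pos hst)
    nlinarith

end IsDriftFunction

/-- The potential of the accumulated rate after time `k`: the increment, over a time `εb * k`, of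
the flow of `φ` started from `w`, normalised to vanish at `w = 1`. -/
noncomputable def potential (φ : ℝ → ℝ) (εb : ℝ) (k : ℕ) (w : ℝ) : ℝ :=
  (Hinv φ (Hfun φ w + εb * k) - Hinv φ (εb * k)) / (εb * φ 1)

/-- The derivative of `potential φ εb k`. -/
noncomputable def potentialSlope (φ : ℝ → ℝ) (εb : ℝ) (k : ℕ) (w : ℝ) : ℝ :=
  φ (Hinv φ (Hfun φ w + εb * k)) / φ w / (εb * φ 1)

namespace IsDriftFunction

variable {φ : ℝ → ℝ} {εb : ℝ}

lemma mul_natCast_nonneg (hε : 0 < εb) (k : ℕ) : 0 ≤ εb * k := by positivity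

lemma potentialSlope_antitoneOn (hφ : IsDriftFunction φ) (hε : 0 < εb) (k : ℕ) :
    AntitoneOn (potentialSlope φ εb k) (Ici 1) := by
  intro a ha b hb hab
  have h := hφ.antitoneOn_comp_Hinv_ratio (mul_natCast_nonneg hε k) (hφ.Hfun_nonneg ha)
    (hφ.Hfun_nonneg hb) (hφ.strictMonoOn_Hfun.monotoneOn ha hb hab)
  simp only [hφ.Hinv_Hfun ha, hφ.Hinv_Hfun hb] at h
  exact div_le_div_of_nonneg_right h (mul_pos hε (hφ.pos 1 le_rfl)).le

lemma potentialSlope_nonneg (hφ : IsDriftFunction φ) (hε : 0 < εb) (k : ℕ) {w : ℝ} (hw : 1 ≤ w) :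
    0 ≤ potentialSlope φ εb k w := by
  have h1 := hφ.pos 1 le_rfl
  have h2 := hφ.pos w hw
  have h3 := hφ.comp_Hinv_pos (add_nonneg (hφ.Hfun_nonneg hw) (mul_natCast_nonneg hε k))
  unfold potentialSlope
  positivity

lemma exists_potential_sub_eq (hφ : IsDriftFunction φ) (hε : 0 < εb) (k : ℕ) {a b : ℝ} (ha : 1 ≤ a)
    (hab : a < b) : ∃ c ∈ Ioo a b,
      potential φ εb k b - potential φ εb k a = potentialSlope φ εb k c * (b - a) := by
  have hk := mul_natCast_nonneg hε k
  have hcont : ContinuousOn (potential φ εb k) (Icc a b) := by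
    refine ContinuousOn.div_const (ContinuousOn.sub (hφ.continuousOn_Hinv.comp
      (ContinuousOn.add (hφ.continuousOn_Hfun.mono fun x hx => ha.trans hx.1) continuousOn_const)
      fun x hx => ?_) continuousOn_const) _
    exact add_nonneg (hφ.Hfun_nonneg (ha.trans hx.1)) hk
  have hderiv : ∀ x ∈ Ioo a b, HasDerivAt (potential φ εb k) (potentialSlope φ εb k x) x := by
    intro x hx
    have hx1 : 1 < x := ha.trans_lt hx.1
    have h := (hφ.hasDerivAt_Hinv (add_pos_of_pos_of_nonneg (hφ.Hfun_pos hx1) hk)).comp x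
      ((hφ.hasDerivAt_Hfun hx1).add_const (εb * k))
    exact (h.sub_const (Hinv φ (εb * k))).div_const (εb * φ 1)
  obtain ⟨c, hc, he⟩ := exists_hasDerivAt_eq_slope _ _ hab hcont hderiv
  exact ⟨c, hc, by rw [he, div_mul_cancel₀ _ (by linarith)]⟩

lemma potential_le_tangent (hφ : IsDriftFunction φ) (hε : 0 < εb) (k : ℕ) {w y : ℝ} (hw : 1 ≤ w)
    (hy : 1 ≤ y) :
    potential φ εb k y ≤ potential φ εb k w + potentialSlope φ εb k w * (y - w) := by
  rcases lt_trichotomy w y with h | rfl | h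
  · obtain ⟨c, hc, he⟩ := hφ.exists_potential_sub_eq hε k hw h
    have := hφ.potentialSlope_antitoneOn hε k hw (hw.trans hc.1.le) hc.1.le
    nlinarith
  · simp
  · obtain ⟨c, hc, he⟩ := hφ.exists_potential_sub_eq hε k hy h
    have := hφ.potentialSlope_antitoneOn hε k (hy.trans hc.1.le) hw hc.2.le
    nlinarith

lemma potential_one (k : ℕ) : potential φ εb k 1 = 0 := by
  simp [potential, Hfun_one]

lemma potentialSlope_one (k : ℕ) :
    potentialSlope φ εb k 1 = rate φ εb k / (εb * φ 1) := by
  simp [potentialSlope, rate, Hfun_one]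

lemma potential_zero (hφ : IsDriftFunction φ) {w : ℝ} (hw : 1 ≤ w) :
    potential φ εb 0 w = (w - 1) / (εb * φ 1) := by
  simp [potential, hφ.Hinv_Hfun hw, hφ.Hinv_zero]

lemma potential_nonneg (hφ : IsDriftFunction φ) (hε : 0 < εb) (k : ℕ) {w : ℝ} (hw : 1 ≤ w) :
    0 ≤ potential φ εb k w := by
  have h1 := hφ.pos 1 le_rfl
  have := hφ.Hinv_mono (mul_natCast_nonneg hε k) (le_add_of_nonneg_left (hφ.Hfun_nonneg hw))
  exact div_nonneg (by linarith) (by positivity)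

lemma potential_le (hφ : IsDriftFunction φ) (hε : 0 < εb) (k : ℕ) {y : ℝ} (hy : 1 ≤ y) :
    potential φ εb k y ≤ rate φ εb k / (εb * φ 1) * (y - 1) := by
  have := hφ.potential_le_tangent hε k le_rfl hy
  rwa [potential_one, potentialSlope_one, zero_add] at this

lemma potentialSlope_le (hφ : IsDriftFunction φ) (hε : 0 < εb) (k : ℕ) {w : ℝ} (hw : 1 ≤ w) :
    potentialSlope φ εb k w ≤ rate φ εb k / (εb * φ 1) := by
  rw [← potentialSlope_one]
  exact hφ.potentialSlope_antitoneOn hε k self_mem_Ici hw hw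

lemma potential_succ_le (hφ : IsDriftFunction φ) (hε : 0 < εb) (k : ℕ) {w : ℝ} (hw : 1 ≤ w) :
    potential φ εb (k + 1) w - εb * φ w * potentialSlope φ εb (k + 1) w ≤
      potential φ εb k w - rate φ εb k := by
  have h1 := hφ.pos 1 le_rfl
  have hφw := hφ.pos w hw
  have hk := mul_natCast_nonneg hε k
  have hk1 : εb * (k + 1 : ℕ) = εb * k + εb := by push_cast; ring
  have hH := hφ.Hfun_nonneg hw
  have hup := (hφ.Hinv_sub_bounds (add_nonneg hH hk)
    (by linarith : Hfun φ w + εb * k ≤ Hfun φ w + (εb * k + εb))).2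
  have hlo := (hφ.Hinv_sub_bounds hk (by linarith : εb * k ≤ εb * k + εb)).1
  have hs : εb * φ w * potentialSlope φ εb (k + 1) w =
      φ (Hinv φ (Hfun φ w + (εb * k + εb))) * εb / (εb * φ 1) := by
    rw [potentialSlope, hk1]; field_simp
  have hr : rate φ εb k = φ (Hinv φ (εb * k)) * εb / (εb * φ 1) := by
    rw [rate]; field_simp
  rw [hs, hr, potential, potential, hk1, ← sub_div, ← sub_div]
  refine div_le_div_of_nonneg_right ?_ (by positivity)
  ring_nf at hup hlo ⊢
  linarith

lemma one_le_rate (hφ : IsDriftFunction φ) (hε : 0 < εb) (k : ℕ) : 1 ≤ rate φ εb k := by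
  have hk := hφ.one_le_Hinv (mul_natCast_nonneg hε k)
  rw [rate, one_le_div (hφ.pos 1 le_rfl)]
  exact hφ.monotoneOn self_mem_Ici hk hk

lemma rate_succ_le_mul (hφ : IsDriftFunction φ) (hε : 0 < εb) (k : ℕ) :
    rate φ εb (k + 1) ≤ rate φ εb 1 * rate φ εb k := by
  have h1 := hφ.pos 1 le_rfl
  have hk := mul_natCast_nonneg hε k
  have h := hφ.antitoneOn_comp_Hinv_ratio hε.le self_mem_Ici hk hk
  simp only [zero_add, hφ.Hinv_zero] at h
  rw [div_le_iff₀ (hφ.comp_Hinv_pos hk)] at h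
  simp only [rate, Nat.cast_add, Nat.cast_one, mul_add, mul_one]
  rw [div_le_iff₀ h1]
  exact h.trans (le_of_eq (by field_simp))

lemma rate_succ_sub_le (hφ : IsDriftFunction φ) (hε : 0 < εb) (k : ℕ) :
    rate φ εb (k + 1) - rate φ εb k ≤ deltaSeq φ εb k * rate φ εb (k + 1) := by
  have h1 := hφ.pos 1 le_rfl
  have h := hφ.comp_Hinv_sub_le (mul_natCast_nonneg hε k) (by linarith : εb * k ≤ εb * k + εb)
  simp only [rate, deltaSeq, Nat.cast_add, Nat.cast_one, mul_add, mul_one]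
  rw [← sub_div, mul_div_assoc']
  refine div_le_div_of_nonneg_right ?_ h1.le
  linarith

lemma deltaSeq_nonneg (hφ : IsDriftFunction φ) (hε : 0 < εb) (k : ℕ) : 0 ≤ deltaSeq φ εb k :=
  mul_nonneg hε.le (hφ.deriv_nonneg (hφ.one_le_Hinv (mul_natCast_nonneg hε k)))

lemma deltaSeq_antitone (hφ : IsDriftFunction φ) (hε : 0 < εb) : Antitone (deltaSeq φ εb) := by
  intro j k hjk
  have h : εb * j ≤ εb * k := by gcongr
  have hj := mul_natCast_nonneg hε j
  exact mul_le_mul_of_nonneg_left (hφ.antitoneOn_deriv (hφ.one_le_Hinv hj)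
    (hφ.one_le_Hinv (hj.trans h)) (hφ.Hinv_mono hj h)) hε.le

lemma tendsto_deltaSeq (hφ : IsDriftFunction φ) (hε : 0 < εb)
    (h0 : Tendsto (deriv φ) atTop (nhds 0)) : Tendsto (deltaSeq φ εb) atTop (nhds 0) := by
  have h : Tendsto (fun k : ℕ => εb * (k : ℝ)) atTop atTop :=
    tendsto_natCast_atTop_atTop.const_mul_atTop hε
  have h' := ((h0.comp hφ.tendsto_Hinv).comp h).const_mul εb
  rw [mul_zero] at h'
  exact h'

end IsDriftFunction

/-- The `j`-th term of the series `cstar`. -/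
noncomputable def visitWeight (φ : ℝ → ℝ) (εb εν bV cV : ℝ) (j : ℕ) : ℝ :=
  (1 - εν) ^ j * ∏ k ∈ Finset.Icc 1 j, (1 + deltaSeq φ εb k * Mone φ εb εν bV cV)

/-- The tail of the series `cstar` from the `j`-th term on, relative to that term. -/
noncomputable def visitTail (φ : ℝ → ℝ) (εb εν bV cV : ℝ) (j : ℕ) : ℝ :=
  (∑' i, visitWeight φ εb εν bV cV (i + j)) / visitWeight φ εb εν bV cV j

/-- The coefficient of the potential in `visitBound`. -/
noncomputable def visitCoeff (φ : ℝ → ℝ) (εb : ℝ) (j : ℕ) : ℝ :=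
  (if j = 0 then 1 else deltaSeq φ εb j) * rate φ εb 1 ^ 2

/-- A bound for the expected rate at the next visit to the small set, after `j` visits, by a pair
of chains at time `k` with joint drift value `w`. -/
noncomputable def visitBound (φ : ℝ → ℝ) (εb : ℝ) (j k : ℕ) (w : ℝ) : ℝ :=
  rate φ εb (k + 1) + visitCoeff φ εb j * potential φ εb k w

/-- A supersolution of the recursion satisfied by the weighted sum of differences from time `k` on,
after `j` visits to the small set. -/
noncomputable def errorBound (φ : ℝ → ℝ) (εb εν bV cV : ℝ) (j k : ℕ) (w : ℝ) : ℝ :=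
  2 * potential φ εb k w + (w - 1) / (εb * φ 1) +
    4 * bV / (εb * φ 1) * (visitTail φ εb εν bV cV j * visitBound φ εb j k w) +
    2 * bV / (εb * φ 1) / εν

namespace IsDriftFunction

variable {φ : ℝ → ℝ} {εb εν bV cV : ℝ}

lemma Mone_nonneg (hφ : IsDriftFunction φ) (hε : 0 < εb) (hν : εν ∈ Ioo (0 : ℝ) 1)
    (hbc : 1 ≤ bV + cV) : 0 ≤ Mone φ εb εν bV cV := by
  have h1 := hφ.pos 1 le_rfl
  have hr := hφ.one_le_rate hε 1
  have hm : 0 < 1 - εν := sub_pos.2 hν.2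
  have : 0 ≤ (bV + cV) / (1 - εν) - 1 := by
    rw [sub_nonneg, one_le_div hm]
    linarith [hν.1]
  unfold Mone
  positivity

lemma visitWeight_pos (hφ : IsDriftFunction φ) (hε : 0 < εb) (hν : εν ∈ Ioo (0 : ℝ) 1)
    (hbc : 1 ≤ bV + cV) (j : ℕ) : 0 < visitWeight φ εb εν bV cV j := by
  refine mul_pos (pow_pos (sub_pos.2 hν.2) _) (Finset.prod_pos fun k _ => ?_)
  have := mul_nonneg (hφ.deltaSeq_nonneg hε k) (hφ.Mone_nonneg hε hν hbc)
  linarith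

lemma visitWeight_succ (j : ℕ) : visitWeight φ εb εν bV cV (j + 1) =
    (1 - εν) * (1 + deltaSeq φ εb (j + 1) * Mone φ εb εν bV cV) *
      visitWeight φ εb εν bV cV j := by
  rw [visitWeight, visitWeight, Finset.prod_Icc_succ_top (by lia)]
  ring

lemma summable_visitWeight (hφ : IsDriftFunction φ) (hε : 0 < εb) (hν : εν ∈ Ioo (0 : ℝ) 1)
    (hbc : 1 ≤ bV + cV) (h0 : Tendsto (deriv φ) atTop (nhds 0)) :
    Summable (visitWeight φ εb εν bV cV) := by
  refine summable_of_ratio_test_tendsto_lt_one (l := 1 - εν) (by linarith [hν.1])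
    (Eventually.of_forall fun j => (hφ.visitWeight_pos hε hν hbc j).ne') ?_
  have h : Tendsto (fun j => (1 - εν) * (1 + deltaSeq φ εb (j + 1) * Mone φ εb εν bV cV)) atTop
      (nhds ((1 - εν) * (1 + 0 * Mone φ εb εν bV cV))) :=
    ((((tendsto_add_atTop_iff_nat 1).2 (hφ.tendsto_deltaSeq hε h0)).mul_const _).const_add
      1).const_mul _
  rw [zero_mul, add_zero, mul_one] at h
  refine h.congr fun j => ?_
  have hj := hφ.visitWeight_pos hε hν hbc j
  rw [Real.norm_of_nonneg hj.le, Real.norm_of_nonneg (hφ.visitWeight_pos hε hν hbc (j + 1)).le,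
    visitWeight_succ, mul_div_cancel_right₀ _ hj.ne']

lemma visitTail_zero : visitTail φ εb εν bV cV 0 = cstar φ εb εν bV cV := by
  simp [visitTail, cstar, visitWeight]

lemma visitTail_nonneg (hφ : IsDriftFunction φ) (hε : 0 < εb) (hν : εν ∈ Ioo (0 : ℝ) 1)
    (hbc : 1 ≤ bV + cV) (j : ℕ) : 0 ≤ visitTail φ εb εν bV cV j :=
  div_nonneg (tsum_nonneg fun _ => (hφ.visitWeight_pos hε hν hbc _).le)
    (hφ.visitWeight_pos hε hν hbc j).le

lemma visitTail_eq (hφ : IsDriftFunction φ) (hε : 0 < εb) (hν : εν ∈ Ioo (0 : ℝ) 1)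
    (hbc : 1 ≤ bV + cV) (h0 : Tendsto (deriv φ) atTop (nhds 0)) (j : ℕ) :
    visitTail φ εb εν bV cV j = 1 + visitTail φ εb εν bV cV (j + 1) *
      ((1 - εν) * (1 + deltaSeq φ εb (j + 1) * Mone φ εb εν bV cV)) := by
  have hj := hφ.visitWeight_pos hε hν hbc j
  have hj1 := hφ.visitWeight_pos hε hν hbc (j + 1)
  have hs := (summable_nat_add_iff j).2 (hφ.summable_visitWeight hε hν hbc h0)
  rw [visitTail, visitTail, hs.tsum_eq_zero_add, zero_add, add_div, div_self hj.ne']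
  simp only [add_assoc, add_comm 1 j]
  congr 1
  have he : (1 - εν) * (1 + deltaSeq φ εb (j + 1) * Mone φ εb εν bV cV) =
      visitWeight φ εb εν bV cV (j + 1) / visitWeight φ εb εν bV cV j := by
    rw [visitWeight_succ, mul_div_cancel_right₀ _ hj.ne']
  rw [he]
  field_simp

lemma visitCoeff_nonneg (hφ : IsDriftFunction φ) (hε : 0 < εb) (j : ℕ) :
    0 ≤ visitCoeff φ εb j := by
  refine mul_nonneg ?_ (sq_nonneg _)
  split_ifs
  exacts [zero_le_one, hφ.deltaSeq_nonneg hε j]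

lemma rate_sub_le_visitCoeff (hφ : IsDriftFunction φ) (hε : 0 < εb) {j k : ℕ} (hjk : j ≤ k) :
    rate φ εb (k + 2) - rate φ εb (k + 1) ≤ visitCoeff φ εb j * rate φ εb k := by
  have hr1 := hφ.one_le_rate hε 1
  have hrk1 := hφ.one_le_rate hε (k + 1)
  have h2 : rate φ εb (k + 2) ≤ rate φ εb 1 ^ 2 * rate φ εb k := by
    nlinarith [hφ.rate_succ_le_mul hε (k + 1), hφ.rate_succ_le_mul hε k]
  rcases Nat.eq_zero_or_pos j with rfl | hj
  · simp only [visitCoeff, if_true, one_mul]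
    linarith
  · rw [visitCoeff, if_neg hj.ne', mul_assoc]
    have hd := hφ.deltaSeq_antitone hε (by lia : j ≤ k + 1)
    have hrk2 := hφ.one_le_rate hε (k + 2)
    refine (hφ.rate_succ_sub_le hε (k + 1)).trans ?_
    exact mul_le_mul hd h2 (by linarith) (hφ.deltaSeq_nonneg hε j)

/-- One step of the recursion away from the small set. -/
lemma exists_affine_errorBound_outside (hφ : IsDriftFunction φ) (hε : 0 < εb)
    (hν : εν ∈ Ioo (0 : ℝ) 1) (hb : 0 < bV) (hbc : 1 ≤ bV + cV) {j k : ℕ} (hjk : j ≤ k)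
    {w γ : ℝ} (hw : 1 ≤ w) (hγ : φ w ≤ γ) :
    ∃ α β, 0 ≤ β ∧ (∀ y, 1 ≤ y → errorBound φ εb εν bV cV j (k + 1) y ≤ α + β * (y - 1)) ∧
      ∀ e, e ≤ w - 1 - εb * γ →
        α + β * e ≤ errorBound φ εb εν bV cV j k w - 2 * rate φ εb k - γ / φ 1 := by
  have h1 := hφ.pos 1 le_rfl
  have hh : 0 < εb * φ 1 := mul_pos hε h1
  have hA := hφ.visitTail_nonneg hε hν hbc j
  have hE := hφ.visitCoeff_nonneg hε j
  have hs := hφ.potentialSlope_nonneg hε (k + 1) hw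
  have htan : ∀ y, 1 ≤ y → potential φ εb (k + 1) y ≤ potential φ εb (k + 1) w +
      potentialSlope φ εb (k + 1) w * (y - w) := fun y hy =>
    hφ.potential_le_tangent hε (k + 1) hw hy
  have hstep := hφ.potential_succ_le hε k hw
  have hr := hφ.rate_sub_le_visitCoeff hε hjk
  simp only [errorBound, visitBound]
  set A := visitTail φ εb εν bV cV j
  set E := visitCoeff φ εb j
  set s := potentialSlope φ εb (k + 1) w
  set p := potential φ εb (k + 1) w
  set q := potential φ εb k w
  have hc : 0 ≤ 4 * bV / (εb * φ 1) := by positivity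
  set c := 4 * bV / (εb * φ 1)
  set B := 2 * bV / (εb * φ 1) / εν
  refine ⟨2 * (p - s * (w - 1)) + c * (A * (rate φ εb (k + 2) + E * (p - s * (w - 1)))) + B,
    2 * s + 1 / (εb * φ 1) + c * (A * (E * s)), by positivity, fun y hy => ?_, fun e he => ?_⟩
  · have h2 := mul_le_mul_of_nonneg_left (htan y hy) (mul_nonneg hc (mul_nonneg hA hE))
    rw [div_eq_mul_one_div (y - 1)]
    linear_combination 2 * htan y hy + h2
  · have h2 : p - s * (w - 1) + s * e ≤ q - rate φ εb k := by
      have h3 := mul_le_mul_of_nonneg_left (he.trans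
        (sub_le_sub_left (mul_le_mul_of_nonneg_left hγ hε.le) _)) hs
      linear_combination h3 + hstep
    have h4 : rate φ εb (k + 2) + E * (p - s * (w - 1) + s * e) ≤ rate φ εb (k + 1) + E * q := by
      linear_combination E * h2 + hr
    have h5 : e / (εb * φ 1) ≤ (w - 1) / (εb * φ 1) - γ / φ 1 := by
      rw [← mul_div_mul_left γ (φ 1) hε.ne', ← sub_div]
      exact div_le_div_of_nonneg_right he hh.le
    have h6 := mul_le_mul_of_nonneg_left (mul_le_mul_of_nonneg_left h4 hA) hc
    linear_combination 2 * h2 + h5 + h6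

/-- One step of the recursion on the small set, where the coupling succeeds with probability
`εν`. -/
lemma exists_affine_errorBound_inside (hφ : IsDriftFunction φ) (hε : 0 < εb)
    (hν : εν ∈ Ioo (0 : ℝ) 1) (hb : 0 < bV) (hbc : 1 ≤ bV + cV)
    (h0 : Tendsto (deriv φ) atTop (nhds 0)) {j k : ℕ} (hjk : j ≤ k)
    {w γ : ℝ} (hw : 1 ≤ w) (hγ : φ w ≤ γ) :
    ∃ α β, 0 ≤ β ∧ (∀ y, 1 ≤ y → errorBound φ εb εν bV cV (j + 1) (k + 1) y ≤ α + β * (y - 1)) ∧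
      ∀ e, e ≤ w - 1 - εb * γ + 2 * bV → e ≤ 2 * (bV + cV) - 2 * (1 - εν) →
        (1 - εν) * α + β * e ≤
          errorBound φ εb εν bV cV j k w - 2 * rate φ εb k - γ / φ 1 := by
  have h1 := hφ.pos 1 le_rfl
  have hh : 0 < εb * φ 1 := mul_pos hε h1
  have hm : 0 < 1 - εν := sub_pos.2 hν.2
  have hA := hφ.visitTail_nonneg hε hν hbc j
  have hA1 := hφ.visitTail_nonneg hε hν hbc (j + 1)
  have hAeq := hφ.visitTail_eq hε hν hbc h0 j
  have hE := hφ.visitCoeff_nonneg hε j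
  have hs := hφ.potentialSlope_nonneg hε (k + 1) hw
  have hsr := hφ.potentialSlope_le hε (k + 1) hw
  have htan : ∀ y, 1 ≤ y → potential φ εb (k + 1) y ≤ potential φ εb (k + 1) w +
      potentialSlope φ εb (k + 1) w * (y - w) := fun y hy =>
    hφ.potential_le_tangent hε (k + 1) hw hy
  have hlin : ∀ y, 1 ≤ y → potential φ εb (k + 1) y ≤
      rate φ εb (k + 1) / (εb * φ 1) * (y - 1) := fun y hy => hφ.potential_le hε (k + 1) hy
  have hstep := hφ.potential_succ_le hε k hw
  have hq := hφ.potential_nonneg hε k hw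
  have hp : 0 ≤ potential φ εb (k + 1) w - potentialSlope φ εb (k + 1) w * (w - 1) := by
    have := htan 1 le_rfl
    rw [potential_one] at this
    linarith
  have hr1 := hφ.one_le_rate hε 1
  have hrk := hφ.one_le_rate hε (k + 1)
  have hδ := hφ.deltaSeq_nonneg hε (j + 1)
  have hr2 : rate φ εb (k + 2) ≤
      rate φ εb (k + 1) * (1 + deltaSeq φ εb (j + 1) * rate φ εb 1) := by
    have h2 := hφ.rate_succ_sub_le hε (k + 1)
    have h3 := mul_le_mul (hφ.deltaSeq_antitone hε (by lia : j + 1 ≤ k + 1))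
      (hφ.rate_succ_le_mul hε (k + 1)) (by linarith [hφ.one_le_rate hε (k + 1 + 1)]) hδ
    linear_combination h2 + h3
  simp only [errorBound, visitBound]
  have hE1 : visitCoeff φ εb (j + 1) = deltaSeq φ εb (j + 1) * rate φ εb 1 ^ 2 := by
    simp [visitCoeff]
  rw [hE1]
  have hM : Mone φ εb εν bV cV = rate φ εb 1 *
    (1 + 2 * rate φ εb 1 / (εb * φ 1) * ((bV + cV) / (1 - εν) - 1)) := rfl
  set M := Mone φ εb εν bV cV
  set A := visitTail φ εb εν bV cV j
  set A' := visitTail φ εb εν bV cV (j + 1)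
  set E := visitCoeff φ εb j
  set δ := deltaSeq φ εb (j + 1)
  set r := rate φ εb 1
  set R := rate φ εb (k + 1)
  set s := potentialSlope φ εb (k + 1) w
  set p := potential φ εb (k + 1) w
  set q := potential φ εb k w
  set h := εb * φ 1 with hh_def
  have hc : 0 ≤ 4 * bV / h := by positivity
  have hR : 0 ≤ R / h := div_nonneg (by linarith) hh.le
  have hr0 : 0 ≤ r := by linarith
  refine ⟨2 * (p - s * (w - 1)) + 4 * bV / h * (A' * rate φ εb (k + 2)) + 2 * bV / h / εν,
    2 * s + 1 / h + 4 * bV / h * (A' * (δ * r ^ 2 * (R / h))), by positivity,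
    fun y hy => ?_, fun e he he' => ?_⟩
  · have h2 := mul_le_mul_of_nonneg_left (hlin y hy)
      (mul_nonneg hc (mul_nonneg hA1 (mul_nonneg hδ (sq_nonneg r))))
    rw [div_eq_mul_one_div (y - 1)]
    linear_combination 2 * htan y hy + h2
  · have h2 : (1 - εν) * (p - s * (w - 1)) + s * e ≤ q - rate φ εb k + 2 * bV * (R / h) := by
      have h3 := mul_le_mul_of_nonneg_left (he.trans (add_le_add_left
        (sub_le_sub_left (mul_le_mul_of_nonneg_left hγ hε.le) _) _)) hs
      have h4 := mul_nonneg hν.1.le hp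
      have h5 := mul_le_mul_of_nonneg_left hsr (by linarith : 0 ≤ 2 * bV)
      linear_combination h3 + hstep + h4 + h5
    have h3 : (1 - εν) * rate φ εb (k + 2) + δ * r ^ 2 * (R / h) * e ≤
        R * ((1 - εν) * (1 + δ * M)) := by
      have h4 := mul_le_mul_of_nonneg_left hr2 hm.le
      have h5 := mul_le_mul_of_nonneg_left he' (mul_nonneg (mul_nonneg hδ (sq_nonneg r)) hR)
      have h6 : R * ((1 - εν) * (1 + δ * M)) = (1 - εν) * (R * (1 + δ * r)) +
          δ * r ^ 2 * (R / h) * (2 * (bV + cV) - 2 * (1 - εν)) := by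
        rw [hM]
        field_simp
        ring
      linarith
    have h4 : e / h ≤ (w - 1) / h - γ / φ 1 + 2 * bV / h := by
      rw [← mul_div_mul_left γ (φ 1) hε.ne', ← hh_def, ← sub_div, ← add_div]
      exact div_le_div_of_nonneg_right he hh.le
    have h5 := mul_le_mul_of_nonneg_left (mul_le_mul_of_nonneg_left h3 hA1) hc
    have h6 : (1 - εν) * (2 * bV / h / εν) = 2 * bV / h / εν - 2 * bV / h := by
      have := hν.1.ne'
      field_simp
    have h7 : 4 * bV / h * (A * R) = 4 * bV * (R / h) +
        4 * bV / h * (A' * (R * ((1 - εν) * (1 + δ * M)))) := by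
      rw [hAeq]
      ring
    have h8 : 0 ≤ 4 * bV / h * (A * (E * q)) := by positivity
    linear_combination 2 * h2 + h4 + h5 + h6 - h7 + h8

lemma errorBound_zero_le (hφ : IsDriftFunction φ) (hε : 0 < εb) (hν : εν ∈ Ioo (0 : ℝ) 1)
    (hb : 0 < bV) (hbc : 1 ≤ bV + cV) {w : ℝ} (hw : 1 ≤ w) :
    errorBound φ εb εν bV cV 0 0 w ≤ cconst φ εb εν bV cV * w := by
  have h1 := hφ.pos 1 le_rfl
  have hr := hφ.one_le_rate hε 1
  have hc : 0 ≤ cstar φ εb εν bV cV := by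
    rw [← visitTail_zero]
    exact hφ.visitTail_nonneg hε hν hbc 0
  rw [errorBound, visitBound, visitTail_zero, hφ.potential_zero hw, visitCoeff, if_pos rfl,
    cconst, bbar, zero_add]
  set r := rate φ εb 1
  set c := cstar φ εb εν bV cV
  set h := εb * φ 1
  have hh : 0 < h := mul_pos hε h1
  have hν0 := hν.1
  have hw0 : 0 ≤ w - 1 := by linarith
  have hr0 : 0 ≤ r := by linarith
  rw [← sub_nonneg]
  have e : 2 / h * (2 + (2 * bV + h) / εν + c * (2 * bV + h) * r * (1 + r / h)) * w -
      (2 * ((w - 1) / h) + (w - 1) / h +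
        4 * bV / h * (c * (r + 1 * r ^ 2 * ((w - 1) / h))) + 2 * bV / h / εν) =
      (w + 3) / h + (2 * h * w + 4 * bV * (w - 1) + 2 * bV) / (h * εν) +
        2 * c * r * (1 + r / h) * w + 4 * bV / h * (c * (r * (w - 1) + r ^ 2 / h)) := by
    field_simp
    ring
  rw [e]
  positivity

end IsDriftFunction

section MarkovKernels

variable {X : Type*} [MeasurableSpace X]

/-- The image of `f` under the kernels `P (k + 1), …, P (k + m)`. -/
noncomputable def backwardIter (P : ℕ → Kernel X X) (f : X → ℝ) : ℕ → ℕ → X → ℝ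
  | _, 0 => f
  | k, m + 1 => fun x => ∫ y, backwardIter P f (k + 1) m y ∂(P (k + 1) x)

/-- A measurable function dominated by an affine function of `V`. -/
def HasLinearGrowth (V g : X → ℝ) : Prop :=
  Measurable g ∧ ∃ a b : ℝ, 0 ≤ b ∧ ∀ x, |g x| ≤ a + b * V x

lemma HasLinearGrowth.integrable {V g : X → ℝ} (hg : HasLinearGrowth V g) {μ : Measure X}
    [IsFiniteMeasure μ] (hV : Integrable V μ) : Integrable g μ := by
  obtain ⟨hm, a, b, -, hab⟩ := hg
  exact ((integrable_const a).add (hV.const_mul b)).mono' hm.aestronglyMeasurable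
    (Eventually.of_forall hab)

lemma HasLinearGrowth.integral_kernel {V g : X → ℝ} (hg : HasLinearGrowth V g) {κ : Kernel X X}
    [IsMarkovKernel κ] (hV : ∀ x, Integrable V (κ x)) {c : ℝ}
    (hc : ∀ x, ∫ y, V y ∂(κ x) ≤ V x + c) : HasLinearGrowth V fun x => ∫ y, g y ∂(κ x) := by
  obtain ⟨hm, a, b, hb, hab⟩ := hg
  refine ⟨hm.stronglyMeasurable.integral_kernel.measurable, a + b * c, b, hb, fun x => ?_⟩
  have hdom : Integrable (fun y => a + b * V y) (κ x) :=
    (integrable_const a).add ((hV x).const_mul b)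
  calc |∫ y, g y ∂(κ x)| ≤ ∫ y, (a + b * V y) ∂(κ x) := by
        rw [← Real.norm_eq_abs]
        exact norm_integral_le_of_norm_le hdom (Eventually.of_forall hab)
    _ = a + b * ∫ y, V y ∂(κ x) := by
        rw [integral_add (integrable_const a) ((hV x).const_mul b), integral_const_mul]
        simp
    _ ≤ a + b * c + b * V x := by nlinarith [mul_le_mul_of_nonneg_left (hc x) hb]

lemma HasLinearGrowth.backwardIter {V f : X → ℝ} {P : ℕ → Kernel X X}
    (hP : ∀ k, IsMarkovKernel (P k)) (hV : ∀ k, 1 ≤ k → ∀ x, Integrable V (P k x)) {c : ℝ}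
    (hc : ∀ k, 1 ≤ k → ∀ x, ∫ y, V y ∂(P k x) ≤ V x + c) (hf : HasLinearGrowth V f) (m : ℕ) :
    ∀ k, HasLinearGrowth V (backwardIter P f k m) := by
  induction m with
  | zero => exact fun _ => hf
  | succ m ih =>
    intro k
    have := hP (k + 1)
    exact (ih (k + 1)).integral_kernel (hV (k + 1) (by lia)) (hc (k + 1) (by lia))

lemma isMarkovKernel_iterKernel {P : ℕ → Kernel X X} (hP : ∀ k, IsMarkovKernel (P k)) (n : ℕ) :
    IsMarkovKernel (iterKernel P n) := by
  induction n with
  | zero => rw [iterKernel]; infer_instance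
  | succ n ih =>
    have := hP (n + 1)
    rw [iterKernel]; infer_instance

lemma integrable_iterKernel {V : X → ℝ} {P : ℕ → Kernel X X} (hVm : Measurable V)
    (hV0 : ∀ x, 0 ≤ V x) (hP : ∀ k, IsMarkovKernel (P k))
    (hV : ∀ k, 1 ≤ k → ∀ x, Integrable V (P k x)) {c : ℝ}
    (hc : ∀ k, 1 ≤ k → ∀ x, ∫ y, V y ∂(P k x) ≤ V x + c) (n : ℕ) (x : X) :
    Integrable V (iterKernel P n x) := by
  induction n with
  | zero =>
    rw [iterKernel, Kernel.id_apply]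
    exact integrable_dirac' hVm.stronglyMeasurable (by simp)
  | succ n ih =>
    have := hP (n + 1)
    have := isMarkovKernel_iterKernel hP n
    rw [iterKernel, integrable_comp_iff hVm.aestronglyMeasurable]
    refine ⟨Eventually.of_forall fun y => hV (n + 1) (by lia) y, ?_⟩
    refine HasLinearGrowth.integrable ?_ ih
    refine HasLinearGrowth.integral_kernel ⟨hVm.norm, 0, 1, zero_le_one, fun y => ?_⟩
      (hV (n + 1) (by lia)) (hc (n + 1) (by lia))
    simp [abs_of_nonneg (hV0 y)]

lemma integral_backwardIter_iterKernel {V f : X → ℝ} {P : ℕ → Kernel X X} (hVm : Measurable V)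
    (hV0 : ∀ x, 0 ≤ V x) (hP : ∀ k, IsMarkovKernel (P k))
    (hV : ∀ k, 1 ≤ k → ∀ x, Integrable V (P k x)) {c : ℝ}
    (hc : ∀ k, 1 ≤ k → ∀ x, ∫ y, V y ∂(P k x) ≤ V x + c) (hf : HasLinearGrowth V f) (x : X)
    (m : ℕ) : ∀ n, ∫ y, backwardIter P f n m y ∂(iterKernel P n x) =
      ∫ y, f y ∂(iterKernel P (n + m) x) := by
  induction m with
  | zero => exact fun _ => rfl
  | succ m ih =>
    intro n
    have := isMarkovKernel_iterKernel hP (n + 1)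
    have hint := (hf.backwardIter hP hV hc m (n + 1)).integrable
      (integrable_iterKernel hVm hV0 hP hV hc (n + 1) x)
    rw [iterKernel] at hint
    rw [show n + (m + 1) = n + 1 + m by lia, ← ih (n + 1), iterKernel, Kernel.integral_comp hint]
    rfl

lemma backwardIter_zero_eq {V f : X → ℝ} {P : ℕ → Kernel X X} (hVm : Measurable V)
    (hV0 : ∀ x, 0 ≤ V x) (hP : ∀ k, IsMarkovKernel (P k))
    (hV : ∀ k, 1 ≤ k → ∀ x, Integrable V (P k x)) {c : ℝ}
    (hc : ∀ k, 1 ≤ k → ∀ x, ∫ y, V y ∂(P k x) ≤ V x + c) (hf : HasLinearGrowth V f) (x : X)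
    (m : ℕ) : backwardIter P f 0 m x = ∫ y, f y ∂(iterKernel P m x) := by
  have h := integral_backwardIter_iterKernel hVm hV0 hP hV hc hf x m 0
  rw [zero_add, iterKernel, Kernel.id_apply,
    integral_dirac' _ _ (hf.backwardIter hP hV hc m 0).1.stronglyMeasurable] at h
  exact h

lemma not_forall_integral_le_sub [Nonempty X] {V : X → ℝ} (hV1 : ∀ x, 1 ≤ V x) {κ : Kernel X X}
    [IsMarkovKernel κ] (hV : ∀ x, Integrable V (κ x)) {γ : ℝ} (hγ : 0 < γ) :
    ¬ ∀ x, ∫ y, V y ∂(κ x) ≤ V x - γ := by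
  intro h
  have key : ∀ (n : ℕ) (x : X), 1 + n * γ ≤ V x := by
    intro n
    induction n with
    | zero => simpa using hV1
    | succ n ih =>
      intro x
      have h1 := integral_mono (integrable_const (1 + n * γ)) (hV x) ih
      simp only [integral_const, probReal_univ, one_smul] at h1
      push_cast
      linarith [h x]
  obtain ⟨x⟩ := ‹Nonempty X›
  obtain ⟨n, hn⟩ := exists_nat_gt (V x / γ)
  rw [div_lt_iff₀ hγ] at hn
  linarith [key n x]

/-- A bound for sums of differences at pairs of points, affine in `V`, can be averaged over two
measures of the same mass. -/
lemma sum_mul_abs_integral_sub_le {ι : Type*} (s : Finset ι) {c : ι → ℝ} (hc : ∀ i ∈ s, 0 ≤ c i)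
    {g : ι → X → ℝ} {V : X → ℝ} {μ μ' : Measure X} [IsFiniteMeasure μ] [IsFiniteMeasure μ'] {m : ℝ}
    (hm : 0 < m) (hμ : μ.real univ = m) (hμ' : μ'.real univ = m)
    (hg : ∀ i ∈ s, Integrable (g i) μ) (hg' : ∀ i ∈ s, Integrable (g i) μ')
    (hV : Integrable V μ) (hV' : Integrable V μ') {α β : ℝ}
    (h : ∀ y y', ∑ i ∈ s, c i * |g i y - g i y'| ≤ α + β * (V y + V y' - 2)) :
    ∑ i ∈ s, c i * |(∫ y, g i y ∂μ) - ∫ y, g i y ∂μ'| ≤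
      m * α + β * ((∫ y, V y ∂μ) + (∫ y, V y ∂μ') - 2 * m) := by
  set σ : ι → ℝ := fun i => SignType.sign ((∫ y, g i y ∂μ) - ∫ y, g i y ∂μ')
  have hσ : ∀ i, |σ i| ≤ 1 := fun i => by
    rcases lt_trichotomy ((∫ y, g i y ∂μ) - ∫ y, g i y ∂μ') 0 with h | h | h <;> simp [σ, h]
  set G : X → ℝ := fun y => ∑ i ∈ s, c i * σ i * g i y
  have hG : Integrable G μ := integrable_finsetSum _ fun i hi => (hg i hi).const_mul _
  have hG' : Integrable G μ' := integrable_finsetSum _ fun i hi => (hg' i hi).const_mul _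
  have hsum : ∑ i ∈ s, c i * |(∫ y, g i y ∂μ) - ∫ y, g i y ∂μ'| =
      (∫ y, G y ∂μ) - ∫ y, G y ∂μ' := by
    rw [integral_finsetSum _ fun i hi => (hg i hi).const_mul _,
      integral_finsetSum _ fun i hi => (hg' i hi).const_mul _, ← Finset.sum_sub_distrib]
    refine Finset.sum_congr rfl fun i _ => ?_
    rw [integral_const_mul, integral_const_mul, ← mul_sub, mul_assoc, sign_mul_self]
  have hGle : ∀ y y', G y ≤ G y' + (α + β * (V y + V y' - 2)) := by
    intro y y'
    have h1 : G y - G y' ≤ ∑ i ∈ s, c i * |g i y - g i y'| := by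
      rw [← Finset.sum_sub_distrib]
      refine Finset.sum_le_sum fun i hi => ?_
      rw [← mul_sub, mul_assoc]
      refine mul_le_mul_of_nonneg_left ((le_abs_self _).trans ?_) (hc i hi)
      rw [abs_mul]
      exact mul_le_of_le_one_left (abs_nonneg _) (hσ i)
    linarith [h y y']
  have hstep : ∀ y', ∫ y, G y ∂μ ≤ m * (G y' + α + β * (V y' - 2)) + β * ∫ y, V y ∂μ := by
    intro y'
    have h1 := integral_mono hG ((integrable_const (G y' + α + β * (V y' - 2))).add
      (hV.const_mul β)) fun y => by
        simp only [Pi.add_apply]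
        linarith [hGle y y']
    rw [integral_add' (integrable_const _) (hV.const_mul β), integral_const_mul, integral_const,
      hμ, smul_eq_mul] at h1
    exact h1
  have h2 := integral_mono (integrable_const (∫ y, G y ∂μ)) (((hG'.add
    (hV'.const_mul β)).const_mul m).add
    (integrable_const (m * (α - 2 * β) + β * ∫ y, V y ∂μ))) fun y' => by
      simp only [Pi.add_apply]
      linarith [hstep y']
  rw [integral_add' (((hG'.add (hV'.const_mul β))).const_mul m) (integrable_const _),
    integral_const_mul, integral_add' hG' (hV'.const_mul β), integral_const_mul, integral_const,
    integral_const, hμ', smul_eq_mul, smul_eq_mul] at h2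
  rw [hsum]
  refine le_of_mul_le_mul_left ?_ hm
  linarith

/-- The part of a probability measure left by removing a dominated multiple of another one. -/
lemma exists_residual {μ ν : Measure X} [IsProbabilityMeasure μ] [IsProbabilityMeasure ν] {ε : ℝ}
    (hε : 0 < ε) (h : ENNReal.ofReal ε • ν ≤ μ) :
    ∃ ρ : Measure X, IsFiniteMeasure ρ ∧ ρ.real univ = 1 - ε ∧ ∀ g : X → ℝ, Integrable g μ →
      Integrable g ν ∧ Integrable g ρ ∧ ∫ y, g y ∂ρ = (∫ y, g y ∂μ) - ε * ∫ y, g y ∂ν := by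
  have hfin : IsFiniteMeasure (ENNReal.ofReal ε • ν) := isFiniteMeasure_of_le μ h
  have hadd : μ - ENNReal.ofReal ε • ν + ENNReal.ofReal ε • ν = μ :=
    Measure.sub_add_cancel_of_le h
  have hρ : IsFiniteMeasure (μ - ENNReal.ofReal ε • ν) := isFiniteMeasure_of_le μ Measure.sub_le
  have hint : ∀ g : X → ℝ, Integrable g μ → Integrable g ν ∧
      Integrable g (μ - ENNReal.ofReal ε • ν) ∧
      ∫ y, g y ∂(μ - ENNReal.ofReal ε • ν) = (∫ y, g y ∂μ) - ε * ∫ y, g y ∂ν := by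
    intro g hg
    have h1 : Integrable g (ENNReal.ofReal ε • ν) := hg.mono_measure h
    have h2 : Integrable g (μ - ENNReal.ofReal ε • ν) := hg.mono_measure Measure.sub_le
    refine ⟨(integrable_smul_measure (by simpa using hε) ENNReal.ofReal_ne_top).1 h1, h2, ?_⟩
    have h3 := integral_add_measure h2 h1
    rw [hadd, integral_smul_measure, ENNReal.toReal_ofReal hε.le, smul_eq_mul] at h3
    linarith
  refine ⟨μ - ENNReal.ofReal ε • ν, hρ, ?_, hint⟩
  simpa using (hint (fun _ => 1) (integrable_const 1)).2.2

end MarkovKernels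

lemma IsDriftFunction.errorBound_nonneg {φ : ℝ → ℝ} {εb εν bV cV : ℝ} (hφ : IsDriftFunction φ)
    (hε : 0 < εb) (hν : εν ∈ Ioo (0 : ℝ) 1) (hb : 0 < bV) (hbc : 1 ≤ bV + cV) (j k : ℕ) {w : ℝ}
    (hw : 1 ≤ w) : 0 ≤ errorBound φ εb εν bV cV j k w := by
  have h1 := hφ.pos 1 le_rfl
  have hA := hφ.visitTail_nonneg hε hν hbc j
  have hE := hφ.visitCoeff_nonneg hε j
  have hq := hφ.potential_nonneg hε k hw
  have hr := hφ.one_le_rate hε (k + 1)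
  have hν0 := hν.1
  have hw0 : 0 ≤ w - 1 := sub_nonneg.2 hw
  unfold errorBound visitBound
  positivity

lemma young_weighted_abs_sub_le {φ Ψ₁ Ψ₂ : ℝ → ℝ} (hφ : IsDriftFunction φ)
    (hΨ₁pos : ∀ t, 1 ≤ t → 0 < Ψ₁ t) (hYoung : ∀ x y : ℝ, 1 ≤ x → 1 ≤ y → Ψ₁ x * Ψ₂ y ≤ x + y)
    {X : Type*} {V f : X → ℝ} (hV1 : ∀ x, 1 ≤ V x) {Mf : ℝ} (hMf : 0 ≤ Mf)
    (hfW : ∀ x, |f x| ≤ Mf * Ψ₂ (φ (V x) / φ 1)) {r : ℝ} (hr : 1 ≤ r) (x x' : X) :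
    Ψ₁ r * |f x - f x'| ≤ Mf * (2 * r + (φ (V x) + φ (V x')) / φ 1) := by
  have key : ∀ z, Ψ₁ r * |f z| ≤ Mf * (r + φ (V z) / φ 1) := fun z => by
    have h1 : 1 ≤ φ (V z) / φ 1 := by
      rw [one_le_div (hφ.pos 1 le_rfl)]
      exact hφ.monotoneOn self_mem_Ici (hV1 z) (hV1 z)
    calc Ψ₁ r * |f z| ≤ Ψ₁ r * (Mf * Ψ₂ (φ (V z) / φ 1)) :=
          mul_le_mul_of_nonneg_left (hfW z) (hΨ₁pos r hr).le
      _ = Mf * (Ψ₁ r * Ψ₂ (φ (V z) / φ 1)) := by ring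
      _ ≤ _ := mul_le_mul_of_nonneg_left (hYoung _ _ hr h1) hMf
  have h1 := mul_le_mul_of_nonneg_left (abs_sub (f x) (f x')) (hΨ₁pos r hr).le
  rw [add_div]
  linarith [key x, key x']

section DriftAndMinorization

variable {X : Type*} [MeasurableSpace X]

lemma exists_mem_small_and_pos {φ V : X → ℝ} {C : Set X} {κ : Kernel X X} [IsMarkovKernel κ]
    [Nonempty X] (hV1 : ∀ x, 1 ≤ V x) (hV : ∀ x, Integrable V (κ x)) {a b : ℝ} (ha : 0 < a)
    (hφ : ∀ x, a ≤ φ x) (hdrift : ∀ x, ∫ y, V y ∂(κ x) ≤ V x - φ x + b * C.indicator 1 x) :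
    C.Nonempty ∧ 0 < b := by
  constructor
  · by_contra hC
    rw [not_nonempty_iff_eq_empty] at hC
    refine not_forall_integral_le_sub hV1 hV ha fun x => ?_
    have := hdrift x
    rw [hC, indicator_empty, mul_zero] at this
    linarith [hφ x]
  · by_contra! hb
    refine not_forall_integral_le_sub hV1 hV ha fun x => ?_
    have h0 : (0 : ℝ) ≤ C.indicator 1 x := indicator_nonneg (fun _ _ => zero_le_one) x
    nlinarith [hdrift x, hφ x]

lemma hasLinearGrowth_of_le_young {φ Ψ₁ Ψ₂ : ℝ → ℝ} (hφ : IsDriftFunction φ)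
    (hΨ₁pos : ∀ t, 1 ≤ t → 0 < Ψ₁ t) (hYoung : ∀ x y : ℝ, 1 ≤ x → 1 ≤ y → Ψ₁ x * Ψ₂ y ≤ x + y)
    {V f : X → ℝ} (hV1 : ∀ x, 1 ≤ V x) (hf : Measurable f) {Mf : ℝ} (hMf : 0 ≤ Mf)
    (hfW : ∀ x, |f x| ≤ Mf * Ψ₂ (φ (V x) / φ 1)) : HasLinearGrowth V f := by
  have h1 := hφ.pos 1 le_rfl
  have hd := hφ.deriv_nonneg le_rfl
  have hΨ := hΨ₁pos 1 le_rfl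
  refine ⟨hf, Mf / Ψ₁ 1 * (1 + (φ 1 - deriv φ 1) / φ 1), Mf / Ψ₁ 1 * (deriv φ 1 / φ 1),
    by positivity, fun x => (hfW x).trans ?_⟩
  have h2 : 1 ≤ φ (V x) / φ 1 := by
    rw [one_le_div h1]
    exact hφ.monotoneOn self_mem_Ici (hV1 x) (hV1 x)
  have h3 : Ψ₂ (φ (V x) / φ 1) ≤ (1 + φ (V x) / φ 1) / Ψ₁ 1 := by
    rw [le_div_iff₀ hΨ, mul_comm]
    exact hYoung 1 _ le_rfl h2
  calc Mf * Ψ₂ (φ (V x) / φ 1) ≤ Mf * ((1 + φ (V x) / φ 1) / Ψ₁ 1) :=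
        mul_le_mul_of_nonneg_left h3 hMf
    _ ≤ Mf * ((1 + (φ 1 + deriv φ 1 * (V x - 1)) / φ 1) / Ψ₁ 1) := by
        gcongr
        exact hφ.le_affine (hV1 x)
    _ = _ := by ring

/-- The weighted sum of differences of backward iterates is dominated by `errorBound`. -/
lemma sum_abs_backwardIter_sub_le {P : ℕ → Kernel X X} (hP : ∀ k, IsMarkovKernel (P k))
    {C : Set X} {V : X → ℝ} (hV1 : ∀ x, 1 ≤ V x) {φ : ℝ → ℝ} (hφ : IsDriftFunction φ)
    (hφderiv0 : Tendsto (deriv φ) atTop (nhds 0))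
    {ν : ℕ → Measure X} (hν : ∀ k, IsProbabilityMeasure (ν k))
    {εν εb : ℝ} (hεν : εν ∈ Ioo (0 : ℝ) 1) (hεb : εb ∈ Ioo (0 : ℝ) 1)
    {bV cV : ℝ} (hb : 0 < bV) (hbc : 1 ≤ bV + cV)
    (hVint : ∀ k, 1 ≤ k → ∀ x, Integrable V (P k x))
    (hdrift : ∀ k, 1 ≤ k → ∀ x, ∫ y, V y ∂(P k x) ≤ V x - φ (V x) + bV * C.indicator 1 x)
    (hminor : ∀ k, 1 ≤ k → ∀ x ∈ C, ENNReal.ofReal εν • ν k ≤ P k x)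
    (hout : ∀ x ∉ C, bV / (1 - εb) ≤ φ (V x)) (hin : ∀ x ∈ C, V x ≤ cV)
    {f : X → ℝ} {Mf : ℝ} (hMf : 0 ≤ Mf) (hgrowth : ∀ k m, HasLinearGrowth V (backwardIter P f k m))
    {ψ : ℕ → ℝ} (hψ : ∀ k, 0 ≤ ψ k)
    (hf : ∀ k x x', ψ k * |f x - f x'| ≤
      Mf * (2 * rate φ εb k + (φ (V x) + φ (V x')) / φ 1)) (N : ℕ) :
    ∀ j k x x', j ≤ k →
      ∑ m ∈ Finset.range N, ψ (k + m) * |backwardIter P f k m x - backwardIter P f k m x'| ≤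
        Mf * errorBound φ εb εν bV cV j k (V x + V x' - 1) := by
  have hw : ∀ x x', 1 ≤ V x + V x' - 1 := fun x x' => by linarith [hV1 x, hV1 x']
  induction N with
  | zero =>
    intro j k x x' _
    rw [Finset.sum_range_zero]
    exact mul_nonneg hMf (hφ.errorBound_nonneg hεb.1 hεν hb hbc j k (hw x x'))
  | succ N ih =>
    intro j k x x' hjk
    have hPk := hP (k + 1)
    have hνk := hν (k + 1)
    have hγ : φ (V x + V x' - 1) ≤ φ (V x) + φ (V x') := by
      linarith [hφ.one_add_le_add (hV1 x) (hV1 x'), hφ.pos 1 le_rfl]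
    have hVx := hVint (k + 1) (by lia)
    have hdx := hdrift (k + 1) (by lia)
    have hgx : ∀ z m, Integrable (backwardIter P f (k + 1) m) (P (k + 1) z) :=
      fun z m => (hgrowth (k + 1) m).integrable (hVx z)
    rw [Finset.sum_range_succ']
    have hshift : ∀ m, ψ (k + (m + 1)) * |backwardIter P f k (m + 1) x -
        backwardIter P f k (m + 1) x'| = ψ (k + 1 + m) *
          |(∫ y, backwardIter P f (k + 1) m y ∂(P (k + 1) x)) -
            ∫ y, backwardIter P f (k + 1) m y ∂(P (k + 1) x')| := fun m => by
      rw [show k + (m + 1) = k + 1 + m by lia]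
      rfl
    simp only [hshift]
    have hfk : ψ (k + 0) * |backwardIter P f k 0 x - backwardIter P f k 0 x'| ≤
        Mf * (2 * rate φ εb k + (φ (V x) + φ (V x')) / φ 1) := hf k x x'
    have hφx := hφ.pos _ (hV1 x)
    have hφx' := hφ.pos _ (hV1 x')
    by_cases hC : x ∈ C ∧ x' ∈ C
    · obtain ⟨α, β, hβ, hle, hstep⟩ := hφ.exists_affine_errorBound_inside hεb.1 hεν hb hbc
        hφderiv0 hjk (hw x x') hγ
      obtain ⟨ρ, hρfin, hρ, hρint⟩ := exists_residual hεν.1 (hminor (k + 1) (by lia) x hC.1)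
      obtain ⟨ρ', hρfin', hρ', hρint'⟩ := exists_residual hεν.1 (hminor (k + 1) (by lia) x' hC.2)
      have hbound := sum_mul_abs_integral_sub_le (Finset.range N) (fun m _ => hψ (k + 1 + m))
        (sub_pos.2 hεν.2) hρ hρ' (fun m _ => (hρint _ (hgx x m)).2.1)
        (fun m _ => (hρint' _ (hgx x' m)).2.1) (hρint _ (hVx x)).2.1 (hρint' _ (hVx x')).2.1
        (α := Mf * α) (β := Mf * β) fun y y' => by
          refine (ih (j + 1) (k + 1) y y' (by lia)).trans ?_
          have := mul_le_mul_of_nonneg_left (hle _ (hw y y')) hMf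
          linarith
      have hcancel : ∀ m, (∫ y, backwardIter P f (k + 1) m y ∂ρ) -
          ∫ y, backwardIter P f (k + 1) m y ∂ρ' =
          (∫ y, backwardIter P f (k + 1) m y ∂(P (k + 1) x)) -
            ∫ y, backwardIter P f (k + 1) m y ∂(P (k + 1) x') := fun m => by
        rw [(hρint _ (hgx x m)).2.2, (hρint' _ (hgx x' m)).2.2]
        ring
      simp only [hcancel] at hbound
      rw [(hρint _ (hVx x)).2.2, (hρint' _ (hVx x')).2.2] at hbound
      have hνV : 1 ≤ ∫ y, V y ∂(ν (k + 1)) := by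
        simpa using integral_mono (integrable_const 1) (hρint _ (hVx x)).1 hV1
      have hνV' := mul_le_mul_of_nonneg_left hνV hεν.1.le
      have hd := hdx x
      have hd' := hdx x'
      rw [indicator_of_mem hC.1, Pi.one_apply, mul_one] at hd
      rw [indicator_of_mem hC.2, Pi.one_apply, mul_one] at hd'
      have hεφ := mul_le_mul_of_nonneg_right hεb.2.le (add_pos hφx hφx').le
      have h := mul_le_mul_of_nonneg_left (hstep ((∫ y, V y ∂(P (k + 1) x)) -
        εν * (∫ y, V y ∂(ν (k + 1))) + ((∫ y, V y ∂(P (k + 1) x')) -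
        εν * ∫ y, V y ∂(ν (k + 1))) - 2 * (1 - εν)) (by linarith)
        (by linarith [hin x hC.1, hin x' hC.2, hεν.1])) hMf
      linarith
    · obtain ⟨α, β, hβ, hle, hstep⟩ := hφ.exists_affine_errorBound_outside hεb.1 hεν hb hbc
        hjk (hw x x') hγ
      have hbound := sum_mul_abs_integral_sub_le (Finset.range N) (fun m _ => hψ (k + 1 + m))
        one_pos probReal_univ probReal_univ (fun m _ => hgx x m) (fun m _ => hgx x' m)
        (hVx x) (hVx x') (α := Mf * α) (β := Mf * β) fun y y' => by
          refine (ih j (k + 1) y y' (by lia)).trans ?_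
          have := mul_le_mul_of_nonneg_left (hle _ (hw y y')) hMf
          linarith
      have hself : ∀ z, bV * C.indicator 1 z - φ (V z) ≤ bV - εb * φ (V z) ∧
          (z ∉ C → bV * C.indicator 1 z - φ (V z) ≤ -bV - εb * φ (V z)) := fun z => by
        have hφz := hφ.pos _ (hV1 z)
        have hε1 : 0 < 1 - εb := sub_pos.2 hεb.2
        by_cases hz : z ∈ C
        · rw [indicator_of_mem hz, Pi.one_apply, mul_one]
          exact ⟨by nlinarith, fun h => absurd hz h⟩
        · have ho := hout z hz
          rw [div_le_iff₀ hε1] at ho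
          rw [indicator_of_notMem hz, mul_zero]
          exact ⟨by linarith, fun _ => by linarith⟩
      have hdec : (∫ y, V y ∂(P (k + 1) x)) + (∫ y, V y ∂(P (k + 1) x')) - 2 ≤
          V x + V x' - 1 - 1 - εb * (φ (V x) + φ (V x')) := by
        have hd := hdx x
        have hd' := hdx x'
        rcases not_and_or.1 hC with h | h
        · linarith [(hself x).2 h, (hself x').1]
        · linarith [(hself x').2 h, (hself x).1]
      have h := mul_le_mul_of_nonneg_left (hstep _ hdec) hMf
      linarith

end DriftAndMinorization

/-- Theorem 2.3 (main theorem): explicit constant for sub-geometric ergodicity. -/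
theorem statement0 {X : Type*} [MeasurableSpace X]
    (P : ℕ → Kernel X X) (hP : ∀ k, IsMarkovKernel (P k))
    (C : Set X) (hC : MeasurableSet C)
    (V : X → ℝ) (hVmeas : Measurable V) (hV1 : ∀ x, 1 ≤ V x)
    (φ : ℝ → ℝ)
    (hφconc : ConcaveOn ℝ (Set.Ici 1) φ)
    (hφmono : MonotoneOn φ (Set.Ici 1))
    (hφdiff : ∀ t, 1 ≤ t → DifferentiableAt ℝ φ t)
    (hφpos : ∀ t, 1 ≤ t → 0 < φ t)
    (hφderiv0 : Tendsto (deriv φ) atTop (nhds 0))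
    (ν : ℕ → Measure X) (hν : ∀ k, IsProbabilityMeasure (ν k))
    (εν εb : ℝ) (hεν : εν ∈ Set.Ioo (0:ℝ) 1) (hεb : εb ∈ Set.Ioo (0:ℝ) 1)
    (bV cV : ℝ)
    (hVint : ∀ k, 1 ≤ k → ∀ x, Integrable V (P k x))
    (hdrift : ∀ k, 1 ≤ k → ∀ x,
      ∫ y, V y ∂(P k x) ≤ V x - φ (V x) + bV * C.indicator 1 x)
    (hminor : ∀ k, 1 ≤ k → ∀ x ∈ C, ∀ A : Set X, MeasurableSet A →
      ENNReal.ofReal εν * ν k A ≤ P k x A)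
    (hout : ∀ x ∉ C, bV / (1 - εb) ≤ φ (V x))
    (hin : ∀ x ∈ C, V x ≤ cV)
    (Ψ₁ Ψ₂ : ℝ → ℝ)
    (hΨ₁mono : MonotoneOn Ψ₁ (Set.Ici 1)) (hΨ₂mono : MonotoneOn Ψ₂ (Set.Ici 1))
    (hΨ₁pos : ∀ t, 1 ≤ t → 0 < Ψ₁ t) (hΨ₂pos : ∀ t, 1 ≤ t → 0 < Ψ₂ t)
    (hYoung : ∀ x y : ℝ, 1 ≤ x → 1 ≤ y → Ψ₁ x * Ψ₂ y ≤ x + y)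
    (f : X → ℝ) (hfmeas : Measurable f)
    (Mf : ℝ) (hfW : ∀ x, |f x| ≤ Mf * Ψ₂ (φ (V x) / φ 1)) :
    ∀ x x' : X,
      ∑' n : ℕ, ENNReal.ofReal (Ψ₁ (rate φ εb n) *
          |(∫ y, f y ∂(iterKernel P n x)) - ∫ y, f y ∂(iterKernel P n x')|) ≤
        ENNReal.ofReal (cconst φ εb εν bV cV * (V x + V x' - 1) * Mf) := by
  intro x x'
  have hφ : IsDriftFunction φ := ⟨hφconc, hφmono, hφdiff, hφpos⟩
  have : Nonempty X := ⟨x⟩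
  have hφ1 : ∀ z, φ 1 ≤ φ (V z) := fun z => hφmono self_mem_Ici (hV1 z) (hV1 z)
  obtain ⟨⟨x₀, hx₀⟩, hb⟩ := by
    have := hP 1
    exact exists_mem_small_and_pos (φ := fun z => φ (V z)) hV1 (hVint 1 le_rfl)
      (hφpos 1 le_rfl) hφ1 (hdrift 1 le_rfl)
  have hbc : 1 ≤ bV + cV := by linarith [hV1 x₀, hin x₀ hx₀]
  have hMf : 0 ≤ Mf := by
    have h1 : 0 < Ψ₂ (φ (V x) / φ 1) :=
      hΨ₂pos _ ((one_le_div (hφpos 1 le_rfl)).2 (hφ1 x))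
    exact nonneg_of_mul_nonneg_left ((abs_nonneg _).trans (hfW x)) h1
  have hdrift' : ∀ k, 1 ≤ k → ∀ z, ∫ y, V y ∂(P k z) ≤ V z + bV := fun k hk z => by
    have h1 : C.indicator (1 : X → ℝ) z ≤ 1 :=
      indicator_apply_le' (fun _ => le_rfl) fun _ => zero_le_one
    nlinarith [hdrift k hk z, hφpos _ (hV1 z)]
  have hf := hasLinearGrowth_of_le_young hφ hΨ₁pos hYoung hV1 hfmeas hMf hfW
  have hr := hφ.one_le_rate hεb.1
  have hw : 1 ≤ V x + V x' - 1 := by linarith [hV1 x, hV1 x']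
  refine ENNReal.tsum_le_of_sum_range_le fun N => ?_
  rw [← ENNReal.ofReal_sum_of_nonneg fun n _ =>
    mul_nonneg (hΨ₁pos _ (hr n)).le (abs_nonneg _)]
  refine ENNReal.ofReal_le_ofReal ?_
  have h := sum_abs_backwardIter_sub_le hP hV1 hφ hφderiv0 hν hεν hεb hb hbc hVint hdrift
    (fun k hk z hz => Measure.le_iff.2 fun A hA => hminor k hk z hz A hA) hout hin hMf
    (fun k m => hf.backwardIter hP hVint hdrift' m k) (fun k => (hΨ₁pos _ (hr k)).le)
    (fun k => young_weighted_abs_sub_le hφ hΨ₁pos hYoung hV1 hMf hfW (hr k)) N 0 0 x x' le_rfl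
  simp only [zero_add, backwardIter_zero_eq hVmeas (fun z => zero_le_one.trans (hV1 z)) hP hVint
    hdrift' hf] at h
  refine h.trans ?_
  rw [mul_comm]
  exact mul_le_mul_of_nonneg_right (hφ.errorBound_zero_le hεb.1 hεν hb hbc hw) hMf
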